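/- (i) For all a>0, ℓ>0: |∂ₐp(a,ℓ)| ≈ a^{-3}·⟨a√ℓ⟩ and |∂ₐκ(a,ℓ)| ≈ a^{-1}·⟨a√ℓ⟩^{-1}·min(1, a²ℓ). (ii) For all θ ≠ 0, a>0, ℓ>0, writing R = R(θ,a,ℓ), p = p(a,ℓ): |sgn(θ)·∂_θR − 1| ≲ p/R, |∂_θR| ≲ ⟨p/R⟩^{1/2} ≲ ⟨1/(a√ℓ)⟩, and |∂ₐR| ≲ (p/a)·ln⟨R/p⟩. -/

import Mathlib

noncomputable section

open Real MeasureTheory Set Filter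

/-- Japanese bracket `⟨x⟩ := √(2+x²)`. -/
def jb (x : ℝ) : ℝ := Real.sqrt (2 + x ^ 2)

/-- `κ(a,ℓ) := (1 + 4a²ℓ/m²)^{-1/2}`. -/
def kpa (m a ℓ : ℝ) : ℝ := 1 / Real.sqrt (1 + 4 * a ^ 2 * ℓ / m ^ 2)

/-- `p(a,ℓ) := m / (2a²κ(a,ℓ))`. -/
def pfn (m a ℓ : ℝ) : ℝ := m / (2 * a ^ 2 * kpa m a ℓ)

/-- `r₀(a,ℓ) := p(a,ℓ)(1-κ(a,ℓ))`. -/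
def rZero (m a ℓ : ℝ) : ℝ := pfn m a ℓ * (1 - kpa m a ℓ)

/-- `G_κ(y) := √(y²-1) - κ ln(y + √(y²-1))`. -/
def Gf (κ y : ℝ) : ℝ := Real.sqrt (y ^ 2 - 1) - κ * Real.log (y + Real.sqrt (y ^ 2 - 1))

/-- `H_κ : [0,∞) → [1,∞)`, the inverse of `G_κ` on `[1,∞)`. -/
def Hf (κ x : ℝ) : ℝ := Function.invFunOn (Gf κ) (Set.Ici 1) x

/-- Inverse hyperbolic cosine `arcosh x = ln (x + √(x²-1))`. -/
def acosh (x : ℝ) : ℝ := Real.log (x + Real.sqrt (x ^ 2 - 1))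

/-- The radial function `R(θ,a,ℓ)`. -/
def Rf (m θ a ℓ : ℝ) : ℝ :=
  pfn m a ℓ * Hf (kpa m a ℓ) (|θ| / pfn m a ℓ) - pfn m a ℓ * kpa m a ℓ

/-- The radial velocity `V(θ,a,ℓ)`. -/
def Vf (m θ a ℓ : ℝ) : ℝ :=
  Real.sign θ * a *
    Real.sqrt (1 + m / (a ^ 2 * Rf m θ a ℓ) - ℓ / (a ^ 2 * (Rf m θ a ℓ) ^ 2))

/-- The dynamical radial function `R̃(t,θ,a,ℓ) = R(θ+at,a,ℓ)`. -/
def Rtil (m t θ a ℓ : ℝ) : ℝ := Rf m (θ + a * t) a ℓ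

/-- The action `𝒜(r,v,ℓ) = √(v² - m/r + ℓ/r²)`. -/
def Acal (m r v ℓ : ℝ) : ℝ := Real.sqrt (v ^ 2 - m / r + ℓ / r ^ 2)

/-- The angle `Θ(r,v,ℓ) = sgn(v)·p(𝒜,ℓ)·G_{κ(𝒜,ℓ)}(r/p(𝒜,ℓ) + κ(𝒜,ℓ))`. -/
def Theta (m r v ℓ : ℝ) : ℝ :=
  Real.sign v * pfn m (Acal m r v ℓ) ℓ *
    Gf (kpa m (Acal m r v ℓ) ℓ) (r / pfn m (Acal m r v ℓ) ℓ + kpa m (Acal m r v ℓ) ℓ)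

/-- The phase space `ℝ×(0,∞)×(0,∞)` in the variables `(θ,a,ℓ)`. -/
def phaseSet : Set (ℝ × ℝ × ℝ) := Set.univ ×ˢ Set.Ioi 0 ×ˢ Set.Ioi 0

/-- The gravitational field
`F(t,r) = -(1/r²)·∫∫∫ 1_{R(θ+ta,a,ℓ) ≤ r} γ(θ,a,ℓ)² dθ da dℓ`. -/
def gravF (m : ℝ) (γ : ℝ × ℝ × ℝ → ℝ) (t r : ℝ) : ℝ :=
  -(1 / r ^ 2) *
    (∫⁻ x in {x : ℝ × ℝ × ℝ | Rf m (x.1 + t * x.2.1) x.2.1 x.2.2 ≤ r},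
        ENNReal.ofReal ((γ x) ^ 2) ∂(volume.restrict phaseSet)).toReal

/-- The effective gravitational field
`F_eff(t,r) = -(1/r²)·∫∫∫ 1_{at ≤ r} γ(θ,a,ℓ)² dθ da dℓ`. -/
def gravFeff (γ : ℝ × ℝ × ℝ → ℝ) (t r : ℝ) : ℝ :=
  -(1 / r ^ 2) *
    (∫⁻ x in {x : ℝ × ℝ × ℝ | x.2.1 * t ≤ r},
        ENNReal.ofReal ((γ x) ^ 2) ∂(volume.restrict phaseSet)).toReal

lemma aux_cd {f g : ℝ → ℝ} {df dg x : ℝ} (h : HasDerivAt f df x) (hfg : ∀ y, g y = f y)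
    (e : dg = df) : HasDerivAt g dg x := by
  have : g = f := funext hfg
  rw [this, e]; exact h

lemma aux_s_pos (m a ℓ : ℝ) (hm : 0 < m) (ha : 0 < a) (hl : 0 < ℓ) :
    0 < kpa m a ℓ ∧ kpa m a ℓ < 1 ∧ (kpa m a ℓ) ^ 2 * (1 + 4 * a ^ 2 * ℓ / m ^ 2) = 1 := by
  have hq : 0 < 4 * a ^ 2 * ℓ / m ^ 2 := by positivity
  have h1 : 1 < Real.sqrt (1 + 4 * a ^ 2 * ℓ / m ^ 2) := by
    rw [Real.lt_sqrt (by norm_num)]; linarith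
  have h2 := Real.sq_sqrt (show 0 ≤ 1 + 4 * a ^ 2 * ℓ / m ^ 2 by linarith)
  unfold kpa
  refine ⟨by positivity, ?_, ?_⟩
  · rw [div_lt_one (by linarith)]; exact h1
  · rw [div_pow, h2]; field_simp

lemma aux_p_pos (m a ℓ : ℝ) (hm : 0 < m) (ha : 0 < a) (hl : 0 < ℓ) : 0 < pfn m a ℓ := by
  have := (aux_s_pos m a ℓ hm ha hl).1
  unfold pfn; positivity

lemma aux_kpa_deriv (m a ℓ : ℝ) (hm : 0 < m) (ha : 0 < a) (hl : 0 < ℓ) :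
    HasDerivAt (fun a' => kpa m a' ℓ) (-(kpa m a ℓ * (1 - kpa m a ℓ ^ 2) / a)) a := by
  obtain ⟨h0, h1, h2⟩ := aux_s_pos m a ℓ hm ha hl
  have hq : 0 < 1 + 4 * a ^ 2 * ℓ / m ^ 2 := by positivity
  have hs : 0 < Real.sqrt (1 + 4 * a ^ 2 * ℓ / m ^ 2) := Real.sqrt_pos.2 hq
  have hd : HasDerivAt (fun a' : ℝ => 1 + 4 * a' ^ 2 * ℓ / m ^ 2) (8 * a * ℓ / m ^ 2) a := by
    have := ((((hasDerivAt_pow 2 a).const_mul 4).mul_const ℓ).div_const (m ^ 2)).const_add 1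
    refine aux_cd this (fun y => rfl) ?_
    norm_num; ring
  have hd2 := (hd.sqrt hq.ne').inv hs.ne'
  refine aux_cd hd2 (fun y => by simp [kpa]) ?_
  have e : kpa m a ℓ = 1 / Real.sqrt (1 + 4 * a ^ 2 * ℓ / m ^ 2) := rfl
  have h3 : Real.sqrt (1 + 4 * a ^ 2 * ℓ / m ^ 2) = 1 / kpa m a ℓ := by rw [e]; field_simp
  rw [h3]
  have h4 : 8 * a * ℓ / m ^ 2 = 2 / a * (1 / kpa m a ℓ ^ 2 - 1) := by
    have : 1 / kpa m a ℓ ^ 2 = 1 + 4 * a ^ 2 * ℓ / m ^ 2 := by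
      rw [div_eq_iff (by positivity)]; linarith
    rw [this]; field_simp; ring
  rw [h4]; field_simp

lemma aux_pfn_deriv (m a ℓ : ℝ) (hm : 0 < m) (ha : 0 < a) (hl : 0 < ℓ) :
    HasDerivAt (fun a' => pfn m a' ℓ) (-((1 + kpa m a ℓ ^ 2) * pfn m a ℓ / a)) a := by
  obtain ⟨h0, h1, h2⟩ := aux_s_pos m a ℓ hm ha hl
  have hk := aux_kpa_deriv m a ℓ hm ha hl
  have := (hasDerivAt_const a m).div (((hasDerivAt_pow 2 a).const_mul 2).mul hk) (by simp only [Pi.mul_apply]; positivity)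
  refine aux_cd this (fun y => rfl) ?_
  simp only [Pi.mul_apply]
  unfold pfn
  norm_num
  field_simp
  ring

lemma aux_G_deriv (κ y : ℝ) (hy : 1 < y) :
    HasDerivAt (fun y => Real.log (y + Real.sqrt (y ^ 2 - 1))) (1 / Real.sqrt (y ^ 2 - 1)) y ∧
    HasDerivAt (Gf κ) ((y - κ) / Real.sqrt (y ^ 2 - 1)) y := by
  have hq : 0 < y ^ 2 - 1 := by nlinarith
  have hs : 0 < Real.sqrt (y ^ 2 - 1) := Real.sqrt_pos.2 hq
  have hd : HasDerivAt (fun y : ℝ => y ^ 2 - 1) (2 * y) y := by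
    refine aux_cd ((hasDerivAt_pow 2 y).sub_const 1) (fun y => rfl) ?_; norm_num
  have h1 := hd.sqrt hq.ne'
  have hp : 0 < y + Real.sqrt (y ^ 2 - 1) := by linarith
  have h2 : HasDerivAt (fun y => Real.log (y + Real.sqrt (y ^ 2 - 1)))
      (1 / Real.sqrt (y ^ 2 - 1)) y := by
    refine aux_cd (HasDerivAt.log ((hasDerivAt_id' y).add h1) hp.ne') (fun y => rfl) ?_
    simp only [Pi.add_apply]
    field_simp
    ring
  refine ⟨h2, ?_⟩
  refine aux_cd (h1.sub (h2.const_mul κ)) (fun y => rfl) ?_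
  field_simp

lemma aux_G_cont (κ : ℝ) : ContinuousOn (Gf κ) (Ici 1) := by
  have hs : ContinuousOn (fun y : ℝ => Real.sqrt (y ^ 2 - 1)) (Ici 1) := by fun_prop
  unfold Gf
  refine hs.sub (continuousOn_const.mul (ContinuousOn.log (continuousOn_id.add hs) ?_))
  intro x hx
  have := Real.sqrt_nonneg (x ^ 2 - 1)
  have hx' : (1 : ℝ) ≤ x := hx
  have : 0 < id x + Real.sqrt (x ^ 2 - 1) := by simp only [id]; linarith
  exact this.ne'

lemma aux_G_mono (κ : ℝ) (hk : κ ≤ 1) : StrictMonoOn (Gf κ) (Ici 1) := by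
  refine strictMonoOn_of_deriv_pos (convex_Ici 1) (aux_G_cont κ) ?_
  intro x hx
  rw [interior_Ici] at hx
  have hx' : (1 : ℝ) < x := hx
  rw [(aux_G_deriv κ x hx').2.deriv]
  have hq : 0 < x ^ 2 - 1 := by nlinarith
  have : 0 < x - κ := by linarith
  have := Real.sqrt_pos.2 hq
  positivity

lemma aux_G_one (κ : ℝ) : Gf κ 1 = 0 := by simp [Gf]

lemma aux_L_le (y : ℝ) (hy : 1 ≤ y) :
    Real.log (y + Real.sqrt (y ^ 2 - 1)) ≤ Real.sqrt (y ^ 2 - 1) := by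
  have := (aux_G_mono 1 le_rfl).monotoneOn (self_mem_Ici) hy hy
  rw [aux_G_one] at this
  unfold Gf at this
  linarith

lemma aux_G_surj (κ x : ℝ) (hk0 : 0 < κ) (hk : κ < 1) (hx : 0 ≤ x) : ∃ y ∈ Ici (1 : ℝ), Gf κ y = x := by
  set t := x / (1 - κ) with ht
  have h1k : 0 < 1 - κ := by linarith
  have ht0 : 0 ≤ t := by positivity
  have hb : x ≤ Gf κ (Real.cosh t) := by
    have e : Real.sqrt (Real.cosh t ^ 2 - 1) = Real.sinh t := by
      rw [Real.cosh_sq, add_sub_cancel_right, Real.sqrt_sq (Real.sinh_nonneg_iff.2 ht0)]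
    unfold Gf
    rw [e, Real.cosh_add_sinh, Real.log_exp]
    have h1 : t ≤ Real.sinh t := Real.self_le_sinh_iff.2 ht0
    have h2 : t * (1 - κ) = x := by rw [ht]; field_simp
    nlinarith
  have hc := Real.one_le_cosh t
  have := intermediate_value_Icc hc ((aux_G_cont κ).mono Icc_subset_Ici_self)
  obtain ⟨y, hy, hyx⟩ := this ⟨by rw [aux_G_one]; exact hx, hb⟩
  exact ⟨y, hy.1, hyx⟩

lemma aux_H (κ x : ℝ) (hk0 : 0 < κ) (hk : κ < 1) (hx : 0 ≤ x) :
    1 ≤ Hf κ x ∧ Gf κ (Hf κ x) = x := by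
  have h : ∃ y ∈ Ici (1 : ℝ), Gf κ y = x := aux_G_surj κ x hk0 hk hx
  exact ⟨Function.invFunOn_mem h, Function.invFunOn_eq h⟩

lemma aux_H_gt (κ x : ℝ) (hk0 : 0 < κ) (hk : κ < 1) (hx : 0 < x) : 1 < Hf κ x := by
  obtain ⟨h1, h2⟩ := aux_H κ x hk0 hk hx.le
  refine lt_of_le_of_ne h1 ?_
  intro h
  rw [← h, aux_G_one] at h2
  linarith

lemma aux_H_mono (κ : ℝ) (hk0 : 0 < κ) (hk : κ < 1) : StrictMonoOn (Hf κ) (Ici 0) := by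
  intro x hx y hy hxy
  obtain ⟨h1, h2⟩ := aux_H κ x hk0 hk hx
  obtain ⟨h3, h4⟩ := aux_H κ y hk0 hk hy
  rw [← (aux_G_mono κ hk.le).lt_iff_lt h1 h3, h2, h4]
  exact hxy

lemma aux_H_deriv (κ x : ℝ) (hk0 : 0 < κ) (hk : κ < 1) (hx : 0 < x) :
    HasDerivAt (Hf κ) (Real.sqrt (Hf κ x ^ 2 - 1) / (Hf κ x - κ)) x := by
  have hy := aux_H_gt κ x hk0 hk hx
  have hc : ContinuousAt (Hf κ) x := by
    refine (aux_H_mono κ hk0 hk).continuousAt_of_image_mem_nhds (Ici_mem_nhds hx) ?_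
    refine Filter.mem_of_superset (Ici_mem_nhds hy) ?_
    intro y hy1
    have hG : 0 ≤ Gf κ y := by
      have := (aux_G_mono κ hk.le).monotoneOn (self_mem_Ici) hy1 hy1
      rwa [aux_G_one] at this
    refine ⟨Gf κ y, hG, ?_⟩
    obtain ⟨h1, h2⟩ := aux_H κ _ hk0 hk hG
    exact (aux_G_mono κ hk.le).injOn h1 hy1 h2
  have hq : 0 < Hf κ x ^ 2 - 1 := by nlinarith
  have hs := Real.sqrt_pos.2 hq
  have hd : 0 < Hf κ x - κ := by linarith
  have := HasDerivAt.of_local_left_inverse hc (aux_G_deriv κ _ hy).2 (by positivity) (by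
    filter_upwards [Ioi_mem_nhds hx] with z hz
    exact (aux_H κ z hk0 hk (le_of_lt hz)).2)
  refine aux_cd this (fun y => rfl) ?_
  rw [inv_div]

lemma aux_sign_sq (θ : ℝ) (hθ : θ ≠ 0) : Real.sign θ * Real.sign θ = 1 ∧ |Real.sign θ| = 1 := by
  rcases lt_or_gt_of_ne hθ with h | h
  · simp [Real.sign_of_neg h]
  · simp [Real.sign_of_pos h]

lemma aux_R_deriv (m θ a ℓ : ℝ) (hm : 0 < m) (ha : 0 < a) (hl : 0 < ℓ) (hθ : θ ≠ 0) :
    HasDerivAt (fun θ' => Rf m θ' a ℓ)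
      (Real.sign θ * (Real.sqrt (Hf (kpa m a ℓ) (|θ| / pfn m a ℓ) ^ 2 - 1) /
        (Hf (kpa m a ℓ) (|θ| / pfn m a ℓ) - kpa m a ℓ))) θ := by
  obtain ⟨h0, h1, h2⟩ := aux_s_pos m a ℓ hm ha hl
  have hp := aux_p_pos m a ℓ hm ha hl
  have hw : 0 < |θ| / pfn m a ℓ := by positivity
  have hH := aux_H_deriv _ _ h0 h1 hw
  have habs : HasDerivAt (fun θ : ℝ => |θ|) (Real.sign θ) θ := by
    rcases lt_or_gt_of_ne hθ with h | h
    · rw [Real.sign_of_neg h]; exact hasDerivAt_abs_neg h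
    · rw [Real.sign_of_pos h]; exact hasDerivAt_abs_pos h
  have := ((hH.comp θ (habs.div_const (pfn m a ℓ))).const_mul (pfn m a ℓ)).sub_const
    (pfn m a ℓ * kpa m a ℓ)
  refine aux_cd this (fun y => rfl) ?_
  field_simp

/-- The `a`-derivative of `R`, when it exists. -/
lemma aux_Ra (m θ a ℓ : ℝ) (hm : 0 < m) (ha : 0 < a) (hl : 0 < ℓ) (hθ : θ ≠ 0)
    (hd : DifferentiableAt ℝ (fun a' => Rf m θ a' ℓ) a) (κ Y S L : ℝ) (hκ : κ = kpa m a ℓ)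
    (hY : Y = Hf κ (|θ| / pfn m a ℓ)) (hS : S = Real.sqrt (Y ^ 2 - 1))
    (hL : L = Real.log (Y + S)) :
    deriv (fun a' => Rf m θ a' ℓ) a =
      pfn m a ℓ / a * ((-1 - 3 * κ ^ 2 + κ * (3 + κ ^ 2) * Y - 2 * κ * S * L) / (Y - κ)) := by
  obtain ⟨h0, h1, h2⟩ := aux_s_pos m a ℓ hm ha hl
  have hp := aux_p_pos m a ℓ hm ha hl
  have hw : 0 < |θ| / pfn m a ℓ := by positivity
  have hY1 : 1 < Y := by rw [hY, hκ]; exact aux_H_gt _ _ h0 h1 hw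
  have hq : 0 < Y ^ 2 - 1 := by nlinarith
  have hSp : 0 < S := by rw [hS]; exact Real.sqrt_pos.2 hq
  have hS2 : S ^ 2 = Y ^ 2 - 1 := by rw [hS]; exact Real.sq_sqrt hq.le
  have hR := hd.hasDerivAt
  set D := deriv (fun a' => Rf m θ a' ℓ) a with hD
  have hk := aux_kpa_deriv m a ℓ hm ha hl
  have hpd := aux_pfn_deriv m a ℓ hm ha hl
  rw [← hκ] at hk hpd h0 h1
  -- the function Y(a)
  set y : ℝ → ℝ := fun a' => Hf (kpa m a' ℓ) (|θ| / pfn m a' ℓ) with hy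
  have hya : y a = Y := by rw [hY, hκ]
  have hRa : Rf m θ a ℓ = pfn m a ℓ * (Y - κ) := by
    rw [hY, hκ]; unfold Rf; ring
  have hyd : HasDerivAt y ((D * pfn m a ℓ - Rf m θ a ℓ * (-((1 + κ ^ 2) * pfn m a ℓ / a)))
      / pfn m a ℓ ^ 2 + -(κ * (1 - κ ^ 2) / a)) a := by
    refine ((hR.div hpd hp.ne').add hk).congr_of_eventuallyEq ?_
    filter_upwards [Ioi_mem_nhds ha] with b hb
    have := aux_p_pos m b ℓ hm hb hl
    simp only [hy, Pi.add_apply, Pi.div_apply, Rf]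
    field_simp
    ring
  set y' := ((D * pfn m a ℓ - Rf m θ a ℓ * (-((1 + κ ^ 2) * pfn m a ℓ / a)))
      / pfn m a ℓ ^ 2 + -(κ * (1 - κ ^ 2) / a)) with hy'
  have hL1 := (aux_G_deriv κ Y hY1).1
  have hsd : HasDerivAt (fun y : ℝ => Real.sqrt (y ^ 2 - 1)) (Y / S) Y := by
    have hd : HasDerivAt (fun y : ℝ => y ^ 2 - 1) (2 * Y) Y := by
      refine aux_cd ((hasDerivAt_pow 2 Y).sub_const 1) (fun y => rfl) ?_; norm_num
    refine aux_cd (hd.sqrt hq.ne') (fun y => rfl) ?_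
    rw [← hS]; field_simp
  rw [← hS] at hL1
  rw [← hya] at hL1 hsd
  have hG := (hsd.comp a hyd).sub (hk.mul (hL1.comp a hyd))
  have hW := (hasDerivAt_const a |θ|).div hpd hp.ne'
  have ev : (fun a' => |θ| / pfn m a' ℓ) =ᶠ[nhds a]
      ((fun y => √(y ^ 2 - 1)) ∘ y - (fun a' => kpa m a' ℓ) *
        (fun y => log (y + √(y ^ 2 - 1))) ∘ y) := by
    filter_upwards [Ioi_mem_nhds ha] with b hb
    obtain ⟨k0, k1, _⟩ := aux_s_pos m b ℓ hm hb hl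
    have := aux_p_pos m b ℓ hm hb hl
    have hx := (aux_H (kpa m b ℓ) (|θ| / pfn m b ℓ) k0 k1 (by positivity)).2
    unfold Gf at hx
    simp only [Pi.sub_apply, Pi.mul_apply, Function.comp, hy]
    exact hx.symm
  have key := (hG.congr_of_eventuallyEq ev).unique hW
  have hGY : |θ| / pfn m a ℓ = S - κ * L := by
    have := (aux_H κ (|θ| / pfn m a ℓ) h0 h1 hw.le).2
    rw [← hY] at this
    rw [← this, hL, hS]; rfl
  have hth : |θ| = pfn m a ℓ * (S - κ * L) := by rw [← hGY]; field_simp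
  simp only [Function.comp, hya, ← hκ, ← hS, ← hL] at key
  rw [hth] at key
  have hYk : 0 < Y - κ := by linarith
  clear_value y'
  generalize pfn m a ℓ = p at *
  have key2 : (Y - κ) * y' = S * (-(κ * (1 - κ ^ 2) / a) * L + (S - κ * L) * (1 + κ ^ 2) / a) := by
    field_simp at key
    field_simp
    apply mul_left_cancel₀ hp.ne'
    linear_combination key
  rw [hy', hRa] at key2
  field_simp at key2
  field_simp
  linear_combination key2 + p * (1 + κ ^ 2) * hS2

lemma aux_log_jb (x : ℝ) : 1 ≤ 3 * Real.log (jb x) ∧ Real.log 4 ≤ 4 * Real.log (jb x) := by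
  have h2 := Real.log_two_gt_d9
  have e : Real.log (jb x) = Real.log (2 + x ^ 2) / 2 := by
    unfold jb; rw [Real.log_sqrt (by positivity)]
  have h : Real.log 2 ≤ Real.log (2 + x ^ 2) :=
    Real.log_le_log (by norm_num) (by nlinarith [sq_nonneg x])
  have h4 : Real.log 4 = 2 * Real.log 2 := by
    rw [show (4 : ℝ) = 2 ^ 2 by norm_num, Real.log_pow]; norm_num
  rw [e, h4]
  constructor <;> linarith

lemma aux_Ra_bound (κ Y S L : ℝ) (h0 : 0 < κ) (h1 : κ < 1) (hY : 1 < Y)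
    (hS : S = Real.sqrt (Y ^ 2 - 1)) (hL : L = Real.log (Y + S)) :
    |(-1 - 3 * κ ^ 2 + κ * (3 + κ ^ 2) * Y - 2 * κ * S * L) / (Y - κ)| ≤
      53 * Real.log (jb (Y - κ)) := by
  have hz : 0 < Y - κ := by linarith
  have hq : 0 < Y ^ 2 - 1 := by nlinarith
  have hSp : 0 < S := by rw [hS]; exact Real.sqrt_pos.2 hq
  have hS2 : S ^ 2 = Y ^ 2 - 1 := by rw [hS]; exact Real.sq_sqrt hq.le
  have hLS : L ≤ S := by rw [hL, hS]; exact aux_L_le Y hY.le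
  have hL0 : 0 ≤ L := by rw [hL]; exact Real.log_nonneg (by linarith)
  obtain ⟨hb1, hb4⟩ := aux_log_jb (Y - κ)
  set b := Real.log (jb (Y - κ)) with hb
  have hSY : S ≤ Y := by nlinarith
  have hSL : S * L ≤ (3 + 10 * b) * (Y - κ) := by
    rcases le_total Y 2 with h | h
    · nlinarith [mul_le_mul_of_nonneg_left hLS hSp.le, mul_pos (show 0 < b by linarith) hz]
    · have hjb : Y - κ ≤ jb (Y - κ) := by
        unfold jb; apply Real.le_sqrt_of_sq_le; linarith
      have hL5 : L ≤ 5 * b := by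
        have : L ≤ Real.log (4 * jb (Y - κ)) := by
          rw [hL]; apply Real.log_le_log (by linarith); linarith
        rw [Real.log_mul (by norm_num) (by linarith)] at this
        linarith
      have hS2' : S ≤ 2 * (Y - κ) := by linarith
      calc S * L ≤ (2 * (Y - κ)) * (5 * b) := by gcongr
        _ ≤ _ := by nlinarith
  have hA : |-1 - 3 * κ ^ 2 + κ * (3 + κ ^ 2) * Y| ≤ 5 * (Y - κ) := by
    have e : -1 - 3 * κ ^ 2 + κ * (3 + κ ^ 2) * Y = -(1 - κ) ^ 3 + κ * (3 + κ ^ 2) * (Y - 1) := by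
      ring
    have hk2 : κ ^ 2 ≤ 1 := by nlinarith
    have hc : κ * (3 + κ ^ 2) ≤ 4 := by nlinarith
    have hc0 : 0 ≤ κ * (3 + κ ^ 2) := by positivity
    have h3 : 0 ≤ (1 - κ) ^ 3 := pow_nonneg (by linarith) 3
    have h3' : (1 - κ) ^ 3 ≤ 1 - κ := by
      have : (1 - κ) ^ 2 ≤ 1 := by nlinarith
      nlinarith
    have h4 : κ * (3 + κ ^ 2) * (Y - 1) ≤ 4 * (Y - 1) := by
      apply mul_le_mul_of_nonneg_right hc; linarith
    have h5 : 0 ≤ κ * (3 + κ ^ 2) * (Y - 1) := mul_nonneg hc0 (by linarith)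
    rw [e, abs_le]
    constructor <;> linarith
  have hB : |2 * κ * S * L| ≤ 2 * ((3 + 10 * b) * (Y - κ)) := by
    rw [abs_of_nonneg (by positivity)]
    nlinarith [mul_nonneg hSp.le hL0]
  rw [abs_div, abs_of_pos hz, div_le_iff₀ hz]
  refine (abs_sub _ _).trans ?_
  nlinarith

lemma aux_jb_cmp (m a ℓ : ℝ) (hm : 0 < m) (ha : 0 < a) (hl : 0 < ℓ) :
    1 ≤ (1 + 2 / m) * (jb (a * Real.sqrt ℓ) * kpa m a ℓ) ∧
      jb (a * Real.sqrt ℓ) * kpa m a ℓ ≤ 2 + m := by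
  obtain ⟨h0, h1, h2⟩ := aux_s_pos m a ℓ hm ha hl
  have hj : jb (a * Real.sqrt ℓ) ^ 2 = 2 + a ^ 2 * ℓ := by
    unfold jb
    rw [Real.sq_sqrt (by positivity), mul_pow, Real.sq_sqrt hl.le]
  have hj0 : 0 < jb (a * Real.sqrt ℓ) := by unfold jb; positivity
  have hx : 0 < a ^ 2 * ℓ := by positivity
  have hk2 : kpa m a ℓ ^ 2 = 1 / (1 + 4 * (a ^ 2 * ℓ) / m ^ 2) := by
    rw [eq_div_iff (by positivity)]; convert h2 using 4; ring
  have hm2 : 0 < 2 / m := by positivity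
  have hle : ∀ x y : ℝ, 0 ≤ y → x ^ 2 ≤ y ^ 2 → x ≤ y := fun x y hy h => (le_abs_self x).trans (abs_le_of_sq_le_sq h hy)
  constructor
  · apply hle _ _ (by positivity)
    rw [mul_pow, mul_pow, hj, hk2, one_pow, mul_one_div, mul_div_assoc', le_div_iff₀ (by positivity)]
    have h3 : 1 + 4 / m ^ 2 ≤ (1 + 2 / m) ^ 2 := by
      have : (2 / m) ^ 2 = 4 / m ^ 2 := by rw [div_pow]; norm_num
      nlinarith
    have h4 : 4 * (a ^ 2 * ℓ) / m ^ 2 = 4 / m ^ 2 * (a ^ 2 * ℓ) := by ring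
    rw [h4]
    have h5 : 0 < 4 / m ^ 2 := by positivity
    nlinarith [mul_le_mul_of_nonneg_right h3 (show 0 ≤ 2 + a ^ 2 * ℓ by positivity)]
  · apply hle _ _ (by positivity)
    rw [mul_pow, hj, hk2, mul_one_div, div_le_iff₀ (by positivity)]
    have h3 : (4 + m ^ 2) * (1 + 4 * (a ^ 2 * ℓ) / m ^ 2) ≤
        (2 + m) ^ 2 * (1 + 4 * (a ^ 2 * ℓ) / m ^ 2) := by
      gcongr; nlinarith
    have h4 : m ^ 2 * (4 * (a ^ 2 * ℓ) / m ^ 2) = 4 * (a ^ 2 * ℓ) := by field_simp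
    have h5 : 0 < 4 * (a ^ 2 * ℓ) / m ^ 2 := by positivity
    nlinarith [sq_nonneg m]

lemma aux_min_cmp (m a ℓ : ℝ) (hm : 0 < m) (ha : 0 < a) (hl : 0 < ℓ) :
    1 - kpa m a ℓ ^ 2 ≤ (1 + 4 / m ^ 2) * min 1 (a ^ 2 * ℓ) ∧
      min 1 (a ^ 2 * ℓ) ≤ (1 + m ^ 2 / 4) * (1 - kpa m a ℓ ^ 2) := by
  obtain ⟨h0, h1, h2⟩ := aux_s_pos m a ℓ hm ha hl
  have hx : 0 < a ^ 2 * ℓ := by positivity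
  have e : 4 * a ^ 2 * ℓ / m ^ 2 = 4 / m ^ 2 * (a ^ 2 * ℓ) := by ring
  rw [e] at h2
  set x := a ^ 2 * ℓ with hxd
  set k := kpa m a ℓ
  set c := 4 / m ^ 2 with hc
  have hc0 : 0 < c := by positivity
  have hmc : m ^ 2 / 4 * c = 1 := by rw [hc]; field_simp
  have hk1 : k ^ 2 < 1 := by nlinarith
  constructor
  · rcases le_total 1 x with h | h
    · rw [min_eq_left h]; nlinarith
    · rw [min_eq_right h]
      have : 1 - k ^ 2 = k ^ 2 * (c * x) := by linarith
      have : k ^ 2 * (c * x) ≤ 1 * (c * x) := by gcongr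
      nlinarith
  · have e1 : 1 - k ^ 2 = k ^ 2 * (c * x) := by linarith
    have e2 : (1 + m ^ 2 / 4) * (1 - k ^ 2) = k ^ 2 * (c * x + x) := by
      rw [e1]; linear_combination k ^ 2 * x * hmc
    have e3 : min 1 x = k ^ 2 * (min 1 x + c * x * min 1 x) := by linear_combination -(min 1 x) * h2
    rw [e2, e3]
    have hcx : 0 < c * x := by positivity
    have := min_le_left 1 x
    have := min_le_right 1 x
    apply mul_le_mul_of_nonneg_left _ (sq_nonneg k)
    nlinarith

/-- part (i) for `p` -/
lemma aux_i_p (m a ℓ : ℝ) (hm : 0 < m) (ha : 0 < a) (hl : 0 < ℓ) :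
    |deriv (fun a' => pfn m a' ℓ) a| ≤ (m * (1 + 2 / m)) * ((a ^ 3)⁻¹ * jb (a * Real.sqrt ℓ)) ∧
    (a ^ 3)⁻¹ * jb (a * Real.sqrt ℓ) ≤ (2 * (2 + m) / m) * |deriv (fun a' => pfn m a' ℓ) a| := by
  obtain ⟨h0, h1, h2⟩ := aux_s_pos m a ℓ hm ha hl
  have hp := aux_p_pos m a ℓ hm ha hl
  obtain ⟨j1, j2⟩ := aux_jb_cmp m a ℓ hm ha hl
  rw [(aux_pfn_deriv m a ℓ hm ha hl).deriv, abs_neg, abs_of_pos (by positivity)]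
  unfold pfn
  set k := kpa m a ℓ
  set j := jb (a * Real.sqrt ℓ)
  have e : (1 + k ^ 2) * (m / (2 * a ^ 2 * k)) / a = (m * (a ^ 3)⁻¹) * ((1 + k ^ 2) / 2 * (1 / k)) := by
    field_simp
  rw [e]
  have hk1 : k ^ 2 < 1 := by nlinarith
  have hk2 := sq_nonneg k
  have j1' : 1 / k ≤ (1 + 2 / m) * j := by rw [div_le_iff₀ h0]; linarith
  have j2' : j ≤ (2 + m) * (1 / k) := by rw [mul_one_div, le_div_iff₀ h0]; linarith
  have hi : 0 < 1 / k := by positivity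
  constructor
  · calc m * (a ^ 3)⁻¹ * ((1 + k ^ 2) / 2 * (1 / k)) ≤ m * (a ^ 3)⁻¹ * ((1 + 2 / m) * j) := by
          apply mul_le_mul_of_nonneg_left _ (by positivity)
          nlinarith
      _ = _ := by ring
  · calc (a ^ 3)⁻¹ * j ≤ (a ^ 3)⁻¹ * ((2 + m) * (2 * ((1 + k ^ 2) / 2 * (1 / k)))) := by
          gcongr
          refine j2'.trans ?_
          gcongr
          nlinarith
      _ = _ := by field_simp

/-- part (i) for `κ` -/
lemma aux_i_k (m a ℓ : ℝ) (hm : 0 < m) (ha : 0 < a) (hl : 0 < ℓ) :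
    |deriv (fun a' => kpa m a' ℓ) a| ≤ ((2 + m) * (1 + 4 / m ^ 2)) *
      (a⁻¹ * (jb (a * Real.sqrt ℓ))⁻¹ * min 1 (a ^ 2 * ℓ)) ∧
    a⁻¹ * (jb (a * Real.sqrt ℓ))⁻¹ * min 1 (a ^ 2 * ℓ) ≤
      ((1 + 2 / m) * (1 + m ^ 2 / 4)) * |deriv (fun a' => kpa m a' ℓ) a| := by
  obtain ⟨h0, h1, h2⟩ := aux_s_pos m a ℓ hm ha hl
  obtain ⟨j1, j2⟩ := aux_jb_cmp m a ℓ hm ha hl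
  obtain ⟨q1, q2⟩ := aux_min_cmp m a ℓ hm ha hl
  have hj0 : 0 < jb (a * Real.sqrt ℓ) := by unfold jb; positivity
  have hmin : 0 < min 1 (a ^ 2 * ℓ) := lt_min one_pos (by positivity)
  have hk1 : 0 < 1 - kpa m a ℓ ^ 2 := by nlinarith
  rw [(aux_kpa_deriv m a ℓ hm ha hl).deriv, abs_neg, abs_of_pos (by positivity)]
  set k := kpa m a ℓ
  set j := jb (a * Real.sqrt ℓ)
  set u := min 1 (a ^ 2 * ℓ)
  have j2' : k ≤ (2 + m) * j⁻¹ := by rw [← div_eq_mul_inv, le_div_iff₀ hj0]; linarith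
  have j1' : j⁻¹ ≤ (1 + 2 / m) * k := by rw [inv_le_iff_one_le_mul₀ hj0]; linarith
  constructor
  · calc k * (1 - k ^ 2) / a = a⁻¹ * (k * (1 - k ^ 2)) := by ring
      _ ≤ a⁻¹ * (((2 + m) * j⁻¹) * ((1 + 4 / m ^ 2) * u)) := by gcongr
      _ = _ := by ring
  · calc a⁻¹ * j⁻¹ * u ≤ a⁻¹ * ((1 + 2 / m) * k) * ((1 + m ^ 2 / 4) * (1 - k ^ 2)) := by gcongr
      _ = _ := by ring

set_option maxHeartbeats 1000000 in
/-- part (ii) -/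
lemma aux_ii (m θ a ℓ : ℝ) (hm : 0 < m) (ha : 0 < a) (hl : 0 < ℓ) (hθ : θ ≠ 0) :
    |Real.sign θ * deriv (fun θ' => Rf m θ' a ℓ) θ - 1| ≤ 1 * (pfn m a ℓ / Rf m θ a ℓ) ∧
    |deriv (fun θ' => Rf m θ' a ℓ) θ| ≤ 2 * Real.sqrt (jb (pfn m a ℓ / Rf m θ a ℓ)) ∧
    Real.sqrt (jb (pfn m a ℓ / Rf m θ a ℓ)) ≤ (2 + m ^ 2) * jb (1 / (a * Real.sqrt ℓ)) ∧
    |deriv (fun a' => Rf m θ a' ℓ) a| ≤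
      53 * (pfn m a ℓ / a) * Real.log (jb (Rf m θ a ℓ / pfn m a ℓ)) := by
  obtain ⟨h0, h1, h2⟩ := aux_s_pos m a ℓ hm ha hl
  have hp := aux_p_pos m a ℓ hm ha hl
  have hw : 0 < |θ| / pfn m a ℓ := by positivity
  obtain ⟨Y, hY⟩ : ∃ Y, Y = Hf (kpa m a ℓ) (|θ| / pfn m a ℓ) := ⟨_, rfl⟩
  obtain ⟨κ, hκ⟩ : ∃ κ, κ = kpa m a ℓ := ⟨_, rfl⟩
  have hY1 : 1 < Y := by rw [hY]; exact aux_H_gt _ _ h0 h1 hw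
  have hRa : Rf m θ a ℓ = pfn m a ℓ * (Y - κ) := by
    rw [hY, hκ]; unfold Rf; ring
  have hθd := (aux_R_deriv m θ a ℓ hm ha hl hθ).deriv
  have hda := aux_Ra m θ a ℓ hm ha hl hθ
  rw [← hY, ← hκ] at hθd
  rw [← hκ] at h0 h1 h2 hY
  have hz : 0 < Y - κ := by linarith
  have e1 : pfn m a ℓ / Rf m θ a ℓ = 1 / (Y - κ) := by rw [hRa]; field_simp
  have e2 : Rf m θ a ℓ / pfn m a ℓ = Y - κ := by rw [hRa]; field_simp
  have hq : 0 < Y ^ 2 - 1 := by nlinarith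
  obtain ⟨S, hS⟩ : ∃ S, S = Real.sqrt (Y ^ 2 - 1) := ⟨_, rfl⟩
  have hSp : 0 < S := by rw [hS]; exact Real.sqrt_pos.2 hq
  have hS2 : S ^ 2 = Y ^ 2 - 1 := by rw [hS]; exact Real.sq_sqrt hq.le
  obtain ⟨s1, s2⟩ := aux_sign_sq θ hθ
  have hSY : S ≤ Y := by nlinarith
  have hbd := aux_Ra_bound κ Y S _ h0 h1 hY1 hS rfl
  have hb1 := (aux_log_jb (Y - κ)).1
  rw [e1, e2, hθd, ← hS]
  refine ⟨?_, ?_, ?_, ?_⟩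
  · rw [← mul_assoc, s1, one_mul, one_mul]
    have : S / (Y - κ) - 1 = (S - (Y - κ)) / (Y - κ) := by field_simp
    rw [this, abs_div, abs_of_pos hz]
    gcongr
    rw [abs_le]
    constructor
    · nlinarith
    · linarith
  · rw [abs_mul, s2, one_mul, abs_of_pos (by positivity)]
    have hx : 0 < 1 / (Y - κ) := by positivity
    have hj : 1 + 2 * (1 / (Y - κ)) ≤ 4 * jb (1 / (Y - κ)) := by
      generalize 1 / (Y - κ) = x at *
      have : (1 + 2 * x) / 4 ≤ jb x := by
        unfold jb; apply Real.le_sqrt_of_sq_le; nlinarith [sq_nonneg (x - 1)]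
      linarith
    have e : (S / (Y - κ)) ^ 2 ≤ 1 + 2 * (1 / (Y - κ)) := by
      have : 1 + 2 * (1 / (Y - κ)) = ((Y - κ + 2) * (Y - κ)) / (Y - κ) ^ 2 := by field_simp
      rw [this, div_pow, hS2]
      gcongr
      nlinarith
    have e3 : S / (Y - κ) ≤ Real.sqrt (2 ^ 2 * jb (1 / (Y - κ))) := by
      apply Real.le_sqrt_of_sq_le; linarith
    rwa [Real.sqrt_mul (by norm_num), Real.sqrt_sq (by norm_num)] at e3
  · have hu : (1 / (a * Real.sqrt ℓ)) ^ 2 = 1 / (a ^ 2 * ℓ) := by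
      rw [div_pow, mul_pow, Real.sq_sqrt hl.le, one_pow]
    unfold jb
    rw [hu]
    have hX : 0 < a ^ 2 * ℓ := by positivity
    have hx0 : 0 < 1 / (Y - κ) := by positivity
    have hv0 : 0 < 1 / (a ^ 2 * ℓ) := by positivity
    have hx : 1 / (Y - κ) ≤ 2 + m ^ 2 / 2 * (1 / (a ^ 2 * ℓ)) := by
      have e3 : 1 / (Y - κ) ≤ 1 / (1 - κ) := by gcongr
      refine e3.trans ?_
      have h1k : 0 < 1 - κ ^ 2 := by
        have := mul_pos (show 0 < 1 - κ by linarith) (show 0 < 1 + κ by linarith)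
        linarith
      have e4 : 2 + m ^ 2 / 2 * (1 / (a ^ 2 * ℓ)) = 2 / (1 - κ ^ 2) := by
        rw [eq_div_iff h1k.ne']
        field_simp at h2 ⊢
        linear_combination (-1) * h2
      rw [e4, div_le_div_iff₀ (by linarith) h1k]
      have := sq_nonneg (1 - κ)
      linarith
    generalize 1 / (Y - κ) = x at *
    generalize 1 / (a ^ 2 * ℓ) = v at *
    have hm2 : 0 < m ^ 2 := by positivity
    have hxx : Real.sqrt (2 + x ^ 2) ≤ 2 + x := by
      rw [Real.sqrt_le_left (by linarith), show (2 + x) ^ 2 = 4 + 4 * x + x ^ 2 by ring]; linarith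
    have : Real.sqrt (2 + x ^ 2) ≤ (2 + m ^ 2) ^ 2 * (2 + v) := by
      have t1 := mul_pos hm2 hv0
      have t2 := mul_pos hm2 hm2
      have t3 := mul_pos (mul_pos hm2 hm2) hv0
      have t4 : (2 + m ^ 2) ^ 2 * (2 + v) = 8 + 4 * v + 8 * m ^ 2 + 4 * (m ^ 2 * v)
        + 2 * (m ^ 2 * m ^ 2) + m ^ 2 * m ^ 2 * v := by ring
      rw [t4]
      linarith
    calc Real.sqrt (Real.sqrt (2 + x ^ 2)) ≤ Real.sqrt ((2 + m ^ 2) ^ 2 * (2 + v)) :=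
          Real.sqrt_le_sqrt this
      _ = _ := by rw [Real.sqrt_mul (by positivity), Real.sqrt_sq (by positivity)]
  · by_cases hd : DifferentiableAt ℝ (fun a' => Rf m θ a' ℓ) a
    · rw [hda hd κ Y S _ hκ hY hS rfl, abs_mul, abs_of_pos (by positivity)]
      calc _ ≤ pfn m a ℓ / a * (53 * Real.log (jb (Y - κ))) := by gcongr
        _ = _ := by ring
    · rw [deriv_zero_of_not_differentiableAt hd, abs_zero]
      have : 0 ≤ Real.log (jb (Y - κ)) := by linarith
      positivity

/-- estimates on the first order derivatives of `p`, `κ` and `R` (constants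
depending only on `m`). -/
theorem statement9 (m : ℝ) (hm : 0 < m) :
    ∃ C : ℝ, 0 < C ∧ ∀ a ℓ : ℝ, 0 < a → 0 < ℓ →
      (|deriv (fun a' => pfn m a' ℓ) a| ≤ C * ((a ^ 3)⁻¹ * jb (a * Real.sqrt ℓ)) ∧
        (a ^ 3)⁻¹ * jb (a * Real.sqrt ℓ) ≤ C * |deriv (fun a' => pfn m a' ℓ) a|) ∧
      (|deriv (fun a' => kpa m a' ℓ) a| ≤
          C * (a⁻¹ * (jb (a * Real.sqrt ℓ))⁻¹ * min 1 (a ^ 2 * ℓ)) ∧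
        a⁻¹ * (jb (a * Real.sqrt ℓ))⁻¹ * min 1 (a ^ 2 * ℓ) ≤
          C * |deriv (fun a' => kpa m a' ℓ) a|) ∧
      ∀ θ : ℝ, θ ≠ 0 →
        |Real.sign θ * deriv (fun θ' => Rf m θ' a ℓ) θ - 1| ≤
          C * (pfn m a ℓ / Rf m θ a ℓ) ∧
        |deriv (fun θ' => Rf m θ' a ℓ) θ| ≤ C * Real.sqrt (jb (pfn m a ℓ / Rf m θ a ℓ)) ∧
        Real.sqrt (jb (pfn m a ℓ / Rf m θ a ℓ)) ≤ C * jb (1 / (a * Real.sqrt ℓ)) ∧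
        |deriv (fun a' => Rf m θ a' ℓ) a| ≤
          C * (pfn m a ℓ / a) * Real.log (jb (Rf m θ a ℓ / pfn m a ℓ)) := by
  obtain ⟨C1, hC1⟩ : ∃ x, x = m * (1 + 2 / m) := ⟨_, rfl⟩
  obtain ⟨C2, hC2⟩ : ∃ x, x = 2 * (2 + m) / m := ⟨_, rfl⟩
  obtain ⟨C3, hC3⟩ : ∃ x, x = (2 + m) * (1 + 4 / m ^ 2) := ⟨_, rfl⟩
  obtain ⟨C4, hC4⟩ : ∃ x, x = (1 + 2 / m) * (1 + m ^ 2 / 4) := ⟨_, rfl⟩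
  have p1 : 0 < C1 := by rw [hC1]; positivity
  have p2 : 0 < C2 := by rw [hC2]; positivity
  have p3 : 0 < C3 := by rw [hC3]; positivity
  have p4 : 0 < C4 := by rw [hC4]; positivity
  have p5 : 0 < m ^ 2 := by positivity
  obtain ⟨C, hC⟩ : ∃ x, x = C1 + C2 + C3 + C4 + m ^ 2 + 60 := ⟨_, rfl⟩
  have mono : ∀ c x y : ℝ, c ≤ C → 0 ≤ y → x ≤ c * y → x ≤ C * y := fun c x y hc hy h =>
    h.trans (mul_le_mul_of_nonneg_right hc hy)
  have hjb : ∀ x : ℝ, 0 ≤ jb x := fun x => Real.sqrt_nonneg _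
  refine ⟨C, by linarith, fun a ℓ ha hl => ?_⟩
  have A := aux_i_p m a ℓ hm ha hl
  have B := aux_i_k m a ℓ hm ha hl
  rw [← hC1, ← hC2] at A
  rw [← hC3, ← hC4] at B
  have hmin : 0 ≤ min 1 (a ^ 2 * ℓ) := le_min zero_le_one (by positivity)
  have hj := hjb (a * Real.sqrt ℓ)
  refine ⟨⟨mono _ _ _ (by linarith) (by positivity) A.1, mono _ _ _ (by linarith) (abs_nonneg _) A.2⟩,
    ⟨mono _ _ _ (by linarith) (by positivity) B.1, mono _ _ _ (by linarith) (abs_nonneg _) B.2⟩,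
    fun θ hθ => ?_⟩
  obtain ⟨D1, D2, D3, D4⟩ := aux_ii m θ a ℓ hm ha hl hθ
  have hp := aux_p_pos m a ℓ hm ha hl
  have hl0 : 0 ≤ Real.log (jb (Rf m θ a ℓ / pfn m a ℓ)) := by
    have := (aux_log_jb (Rf m θ a ℓ / pfn m a ℓ)).1
    linarith
  refine ⟨mono _ _ _ (by linarith) ?_ D1, mono _ _ _ (by linarith) (Real.sqrt_nonneg _) D2,
    mono _ _ _ (by linarith) (hjb _) D3, ?_⟩
  · have := (abs_nonneg _).trans D1
    linarith
  · rw [mul_assoc] at D4 ⊢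
    exact mono _ _ _ (by linarith) (by positivity) D4
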